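/- Let a₀, a₁, a₂ ∈ ℝ with a₀ ≠ 0, and let λ₁ and λ₂ be nonzero real roots of the characteristic equation a₀λ² + a₁λ + a₂ = 0. Then the constant-coefficient equation a₀x'' + a₁x' + a₂x = 0 is Ulam stable on ℝ, and its minimum Ulam constant is 1/|a₀ λ₁ λ₂|. -/

import Mathlib

open MeasureTheory Set

/-- `L` is an Ulam constant for the constant-coefficient equation
`a₀ x'' + a₁ x' + a₂ x = 0` on `ℝ` (for `ℝⁿ`-valued functions). -/
def IsUlamConstant (n : ℕ) (a₀ a₁ a₂ : ℝ) (L : ℝ) : Prop :=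
  0 < L ∧ ∀ ε > 0, ∀ ξ ξd ξdd : ℝ → EuclideanSpace ℝ (Fin n),
    (∀ t, HasDerivAt ξ (ξd t) t) →
    (∀ t, HasDerivAt ξd (ξdd t) t) →
    Continuous ξdd →
    (∀ t, ‖a₀ • ξdd t + a₁ • ξd t + a₂ • ξ t‖ ≤ ε) →
    ∃ x xd xdd : ℝ → EuclideanSpace ℝ (Fin n),
      (∀ t, HasDerivAt x (xd t) t) ∧
      (∀ t, HasDerivAt xd (xdd t) t) ∧
      Continuous xdd ∧
      (∀ t, a₀ • xdd t + a₁ • xd t + a₂ • x t = 0) ∧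
      ∀ t, ‖ξ t - x t‖ ≤ L * ε

/-- A vector whose multiples by `exp (c * t)`, `t ∈ ℝ`, stay bounded vanishes if `c ≠ 0`. -/
theorem eq_zero_of_norm_exp_smul_le {E : Type*} [NormedAddCommGroup E] [NormedSpace ℝ E]
    {c C : ℝ} (hc : c ≠ 0) {v : E} (h : ∀ t : ℝ, ‖Real.exp (c * t) • v‖ ≤ C) : v = 0 := by
  by_contra hv
  have hpos : 0 < ‖v‖ := norm_pos_iff.mpr hv
  have h1 := h (C / ‖v‖ / c)
  rw [norm_smul, Real.norm_eq_abs, Real.abs_exp, mul_div_cancel₀ _ hc] at h1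
  have h2 := mul_le_mul_of_nonneg_right (Real.add_one_le_exp (C / ‖v‖)) hpos.le
  rw [add_mul, div_mul_cancel₀ _ hpos.ne'] at h2
  linarith

theorem hasDerivAt_exp_const_mul (c t : ℝ) :
    HasDerivAt (fun s : ℝ => Real.exp (c * s)) (c * Real.exp (c * t)) t := by
  simpa [mul_comm] using ((hasDerivAt_id t).const_mul c).exp

/-- Solutions of `y' = c y` are multiples of the exponential. -/
theorem eq_exp_smul_of_hasDerivAt {E : Type*} [NormedAddCommGroup E] [NormedSpace ℝ E]
    {c : ℝ} {y : ℝ → E} (h : ∀ t, HasDerivAt y (c • y t) t) (t : ℝ) :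
    y t = Real.exp (c * t) • y 0 := by
  have hd : ∀ s, HasDerivAt (fun s => Real.exp (-c * s) • y s) 0 s := fun s => by
    refine HasDerivAt.congr_deriv ((hasDerivAt_exp_const_mul (-c) s).smul (h s)) ?_
    module
  have hconst := is_const_of_deriv_eq_zero (fun s => (hd s).differentiableAt)
    (fun s => (hd s).deriv) t 0
  simp only [mul_zero, Real.exp_zero, one_smul] at hconst
  rw [← hconst, smul_smul, ← Real.exp_add]
  simp

/-- A bounded solution on `ℝ` of `(D - c₁) (D - c₂) x = 0` with `c₁, c₂ ≠ 0` vanishes. -/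
theorem eq_zero_of_bounded_of_hasDerivAt {E : Type*} [NormedAddCommGroup E] [NormedSpace ℝ E]
    {c₁ c₂ C : ℝ} (hc₁ : c₁ ≠ 0) (hc₂ : c₂ ≠ 0) {x z : ℝ → E}
    (hx : ∀ t, HasDerivAt x (c₂ • x t + z t) t) (hz : ∀ t, HasDerivAt z (c₁ • z t) t)
    (hC : ∀ t, ‖x t‖ ≤ C) (t : ℝ) : x t = 0 := by
  have hzexp := eq_exp_smul_of_hasDerivAt hz
  have hg : ∀ t, HasDerivAt (fun t => x t - c₁⁻¹ • z t) (c₂ • x t) t := fun t => by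
    refine HasDerivAt.congr_deriv ((hx t).sub ((hz t).const_smul c₁⁻¹)) ?_
    rw [smul_smul, inv_mul_cancel₀ hc₁]
    module
  have hgb : ∀ t : ℝ, ‖(x (t + 1) - c₁⁻¹ • z (t + 1)) - (x t - c₁⁻¹ • z t)‖ ≤ |c₂| * C := by
    intro t
    have := convex_univ.norm_image_sub_le_of_norm_hasDerivWithin_le (s := Set.univ)
      (C := |c₂| * C) (fun s _ => (hg s).hasDerivWithinAt)
      (fun s _ => by
        rw [norm_smul, Real.norm_eq_abs]
        exact mul_le_mul_of_nonneg_left (hC s) (abs_nonneg _))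
      (Set.mem_univ t) (Set.mem_univ (t + 1))
    simpa using this
  have hv : (c₁⁻¹ * (Real.exp c₁ - 1)) • z 0 = 0 := by
    refine eq_zero_of_norm_exp_smul_le hc₁ (C := |c₂| * C + C + C) fun t => ?_
    have heq : Real.exp (c₁ * t) • (c₁⁻¹ * (Real.exp c₁ - 1)) • z 0
        = x (t + 1) - x t - ((x (t + 1) - c₁⁻¹ • z (t + 1)) - (x t - c₁⁻¹ • z t)) := by
      rw [hzexp (t + 1), hzexp t, mul_add, Real.exp_add, mul_one]
      module
    rw [heq]
    have h1 := norm_sub_le (x (t + 1) - x t)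
      ((x (t + 1) - c₁⁻¹ • z (t + 1)) - (x t - c₁⁻¹ • z t))
    have h2 := norm_sub_le (x (t + 1)) (x t)
    linarith [hgb t, hC (t + 1), hC t]
  have hz0 : z 0 = 0 := by
    refine (smul_eq_zero.mp hv).resolve_left (mul_ne_zero (inv_ne_zero hc₁) ?_)
    rw [sub_ne_zero, Ne, Real.exp_eq_one_iff]
    exact hc₁
  have hxexp := eq_exp_smul_of_hasDerivAt (y := x) (c := c₂) fun t => by
    simpa [hzexp t, hz0] using hx t
  have hx0 : x 0 = 0 := eq_zero_of_norm_exp_smul_le hc₂ (C := C) fun t => hxexp t ▸ hC t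
  rw [hxexp t, hx0, smul_zero]

theorem exists_bounded_hasDerivAt_of_pos {E : Type*} [NormedAddCommGroup E] [NormedSpace ℝ E]
    [CompleteSpace E] {c M : ℝ} (hc : 0 < c) {f : ℝ → E} (hf : Continuous f)
    (hM : ∀ t, ‖f t‖ ≤ M) :
    ∃ y : ℝ → E, (∀ t, HasDerivAt y (c • y t + f t) t) ∧ ∀ t, ‖y t‖ ≤ M / c := by
  set h : ℝ → E := fun s => Real.exp (-c * s) • f s with hh
  have hcont : Continuous h := by fun_prop
  have hnorm : ∀ s, ‖h s‖ ≤ Real.exp (-c * s) * M := fun s => by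
    rw [hh, norm_smul, Real.norm_eq_abs, Real.abs_exp]
    exact mul_le_mul_of_nonneg_left (hM s) (Real.exp_nonneg _)
  have hexp : ∀ t, IntegrableOn (fun s => Real.exp (-c * s) * M) (Ioi t) := fun t =>
    (integrableOn_exp_mul_Ioi (neg_lt_zero.mpr hc) t).mul_const M
  have hint : ∀ t, IntegrableOn h (Ioi t) := fun t =>
    (hexp t).mono' hcont.aestronglyMeasurable (ae_of_all _ hnorm)
  refine ⟨fun t => Real.exp (c * t) • ((∫ s in (0 : ℝ)..t, h s) - ∫ s in Ioi 0, h s),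
    fun t => ?_, fun t => ?_⟩
  · refine HasDerivAt.congr_deriv ((hasDerivAt_exp_const_mul c t).smul
      ((hcont.integral_hasStrictDerivAt 0 t).hasDerivAt.sub_const (∫ s in Ioi 0, h s))) ?_
    rw [hh, smul_smul (Real.exp (c * t)) (Real.exp (-c * t)), ← Real.exp_add]
    simp only [neg_mul, add_neg_cancel, Real.exp_zero, one_smul]
    module
  · have hsplit : (∫ s in (0 : ℝ)..t, h s) - ∫ s in Ioi 0, h s = -∫ s in Ioi t, h s := by
      rw [← intervalIntegral.integral_interval_add_Ioi (hint 0) (hint t)]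
      abel
    have hle : ‖∫ s in Ioi t, h s‖ ≤ Real.exp (-c * t) / c * M := by
      refine (norm_integral_le_of_norm_le (hexp t) (ae_of_all _ hnorm)).trans_eq ?_
      rw [integral_mul_const, integral_exp_mul_Ioi (neg_lt_zero.mpr hc), neg_div_neg_eq]
    simp only [hsplit]
    rw [norm_smul, norm_neg, Real.norm_eq_abs, Real.abs_exp]
    refine (mul_le_mul_of_nonneg_left hle (Real.exp_nonneg _)).trans_eq ?_
    rw [← mul_assoc, ← mul_div_assoc, ← Real.exp_add]
    simp only [neg_mul, add_neg_cancel, Real.exp_zero]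
    ring

/-- For `c ≠ 0` and `f` bounded by `M`, the equation `y' = c y + f` has a solution on `ℝ`
bounded by `M / |c|`. -/
theorem exists_bounded_hasDerivAt {E : Type*} [NormedAddCommGroup E] [NormedSpace ℝ E]
    [CompleteSpace E] {c M : ℝ} (hc : c ≠ 0) {f : ℝ → E} (hf : Continuous f)
    (hM : ∀ t, ‖f t‖ ≤ M) :
    ∃ y : ℝ → E, (∀ t, HasDerivAt y (c • y t + f t) t) ∧ ∀ t, ‖y t‖ ≤ M / |c| := by
  rcases hc.lt_or_gt with hneg | hpos
  · obtain ⟨g, hg, hgM⟩ := exists_bounded_hasDerivAt_of_pos (neg_pos.mpr hneg)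
      (f := fun t => f (-t)) (by fun_prop) (fun t => hM (-t))
    refine ⟨fun t => -g (-t), fun t => ?_, fun t => ?_⟩
    · refine HasDerivAt.congr_deriv (((hg (-t)).scomp t (hasDerivAt_neg t)).neg) ?_
      rw [neg_neg]
      module
    · rw [norm_neg, abs_of_neg hneg]
      exact hgM (-t)
  · rw [abs_of_pos hpos]
    exact exists_bounded_hasDerivAt_of_pos hpos hf hM

/-- Corollary 4.2. If `λ₁, λ₂` are nonzero real roots of
`a₀ λ² + a₁ λ + a₂ = 0` with `a₀ ≠ 0`, then `a₀ x'' + a₁ x' + a₂ x = 0` is Ulam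
stable on `ℝ` with minimum Ulam constant `1/|a₀ λ₁ λ₂|`. -/
theorem const_coeff_best_ulam_constant (n : ℕ) (hn : 0 < n)
    (a₀ a₁ a₂ lam₁ lam₂ : ℝ) (h₀ : a₀ ≠ 0) (hlam₁ : lam₁ ≠ 0) (hlam₂ : lam₂ ≠ 0)
    (hroots : ∀ z : ℝ, a₀ * z ^ 2 + a₁ * z + a₂ = a₀ * (z - lam₁) * (z - lam₂)) :
    (∃ L, IsUlamConstant n a₀ a₁ a₂ L) ∧
      IsUlamConstant n a₀ a₁ a₂ (1 / |a₀ * lam₁ * lam₂|) ∧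
      ∀ L, IsUlamConstant n a₀ a₁ a₂ L → 1 / |a₀ * lam₁ * lam₂| ≤ L := by
  have ha₂ : a₂ = a₀ * lam₁ * lam₂ := by linear_combination hroots 0
  have ha₁ : a₁ = -(a₀ * (lam₁ + lam₂)) := by linear_combination hroots 1 - hroots 0
  have hne : a₀ * lam₁ * lam₂ ≠ 0 := mul_ne_zero (mul_ne_zero h₀ hlam₁) hlam₂
  have hbest : IsUlamConstant n a₀ a₁ a₂ (1 / |a₀ * lam₁ * lam₂|) := by
    refine ⟨by positivity, fun ε _ ξ ξd ξdd hξ hξd hcont hε => ?_⟩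
    have hξc : Continuous ξ := continuous_iff_continuousAt.mpr fun t => (hξ t).continuousAt
    have hξdc : Continuous ξd := continuous_iff_continuousAt.mpr fun t => (hξd t).continuousAt
    set f := fun t => a₀⁻¹ • (a₀ • ξdd t + a₁ • ξd t + a₂ • ξ t) with hf
    have hfc : Continuous f := by fun_prop
    have hfM : ∀ t, ‖f t‖ ≤ |a₀|⁻¹ * ε := fun t => by
      rw [hf, norm_smul, norm_inv, Real.norm_eq_abs]
      exact mul_le_mul_of_nonneg_left (hε t) (by positivity)
    obtain ⟨u, hu, huM⟩ := exists_bounded_hasDerivAt hlam₁ hfc hfM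
    have huc : Continuous u := continuous_iff_continuousAt.mpr fun t => (hu t).continuousAt
    obtain ⟨y, hy, hyM⟩ := exists_bounded_hasDerivAt hlam₂ huc huM
    have hyc : Continuous y := continuous_iff_continuousAt.mpr fun t => (hy t).continuousAt
    refine ⟨fun t => ξ t - y t, fun t => ξd t - (lam₂ • y t + u t),
      fun t => ξdd t - (lam₂ • (lam₂ • y t + u t) + (lam₁ • u t + f t)),
      fun t => (hξ t).sub (hy t), fun t => (hξd t).sub (((hy t).const_smul lam₂).add (hu t)),
      by fun_prop, fun t => ?_, fun t => ?_⟩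
    · have hft : a₀ • f t = a₀ • ξdd t + a₁ • ξd t + a₂ • ξ t := by
        rw [hf, smul_smul, mul_inv_cancel₀ h₀, one_smul]
      calc _ = (a₀ • ξdd t + a₁ • ξd t + a₂ • ξ t) - a₀ • f t := by
            rw [ha₁, ha₂]
            module
        _ = 0 := by rw [hft, sub_self]
    · rw [sub_sub_cancel]
      refine (hyM t).trans_eq ?_
      rw [abs_mul, abs_mul]
      field_simp
  refine ⟨⟨_, hbest⟩, hbest, fun L hL => ?_⟩
  set v : EuclideanSpace ℝ (Fin n) := EuclideanSpace.single ⟨0, hn⟩ a₂⁻¹ with hv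
  have hvn : ‖v‖ = 1 / |a₀ * lam₁ * lam₂| := by simp [hv, ha₂]
  have ha₂v : ‖a₂ • v‖ = 1 := by
    rw [norm_smul, hvn, ha₂, Real.norm_eq_abs]
    exact mul_one_div_cancel (abs_ne_zero.mpr hne)
  obtain ⟨x, xd, xdd, hx, hxd, -, heq, hxL⟩ := hL.2 1 one_pos (fun _ => v) (fun _ => 0)
    (fun _ => 0) (fun t => hasDerivAt_const t v) (fun t => hasDerivAt_const t 0)
    continuous_const (fun t => by simp [ha₂v])
  have hx0 : x 0 = 0 := by
    refine eq_zero_of_bounded_of_hasDerivAt hlam₁ hlam₂ (C := ‖v‖ + L * 1)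
      (z := fun t => xd t - lam₂ • x t) (fun t => ?_) (fun t => ?_) (fun t => ?_) 0
    · simpa using hx t
    · refine HasDerivAt.congr_deriv ((hxd t).sub ((hx t).const_smul lam₂)) ?_
      have h : xdd t = a₀⁻¹ • (a₀ • xdd t + a₁ • xd t + a₂ • x t)
          + (lam₁ + lam₂) • xd t - (lam₁ * lam₂) • x t := by
        rw [ha₁, ha₂]
        match_scalars <;> field_simp <;> ring
      rw [h, heq t]
      module
    · have h := norm_sub_le v (v - x t)
      rw [sub_sub_cancel] at h
      exact h.trans (add_le_add_right (hxL t) _)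
  have h := hxL 0
  rwa [hx0, sub_zero, mul_one, hvn] at h
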